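/- arXiv:2307.00896 — 2 statements merged into one kernel-verified Lean document; each statement's English description precedes it below -/
import Mathlib

section
/- For every α ∈ (0,2), the function R : (0,1) → ℝ defined by R(a) = C_α ( T_α a^{-α/2} + α^{-1} a^{α/2} F_α(a) ) satisfies lim_{a→0⁺} R(a) = ∞ and lim_{a→1⁻} R(a) = ∞. -/
open MeasureTheory Real Filter Set

/-- Euler Beta function `B(x,y) = ∫₀¹ t^(x-1) (1-t)^(y-1) dt`. -/
noncomputable def betaFn (x y : ℝ) : ℝ :=
  ∫ t in (0:ℝ)..1, t ^ (x - 1) * (1 - t) ^ (y - 1)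

/-- `C_α = π⁻¹ sin(π α / 2)`. -/
noncomputable def Cc (α : ℝ) : ℝ := Real.sin (Real.pi * α / 2) / Real.pi

/-- `T_α = B(α, 1 - α/2)`. -/
noncomputable def Tc (α : ℝ) : ℝ := betaFn α (1 - α / 2)

/-- Gauss hypergeometric series `₂F₁(p, q; r; z)`. -/
noncomputable def hyp (p q r z : ℝ) : ℝ :=
  ∑' n : ℕ, ((ascPochhammer ℝ n).eval p * (ascPochhammer ℝ n).eval q) /
    ((ascPochhammer ℝ n).eval r * (n.factorial : ℝ)) * z ^ n

/-- `R(a) = C_α (T_α a^(-α/2) + α⁻¹ a^(α/2) F_α(a))` where `F_α(a) = ₂F₁(α/2+1, α; α+1; a)`. -/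
noncomputable def Rf (α a : ℝ) : ℝ :=
  Cc α * (Tc α * a ^ (-(α / 2)) + α⁻¹ * a ^ (α / 2) * hyp (α / 2 + 1) α (α + 1) a)

theorem betaFn_pos {x y : ℝ} (hx : 0 < x) (hy : 0 < y) : 0 < betaFn x y := by
  have h : (betaFn x y : ℂ) = Complex.betaIntegral x y := by
    rw [betaFn, Complex.betaIntegral, ← intervalIntegral.integral_ofReal]
    refine intervalIntegral.integral_congr fun t ht ↦ ?_
    rw [Set.uIcc_of_le zero_le_one] at ht
    simp only [Complex.ofReal_mul]
    rw [Complex.ofReal_cpow ht.1, Complex.ofReal_cpow (sub_nonneg.2 ht.2)]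
    push_cast
    rfl
  have h' := ProbabilityTheory.beta_pos hx hy
  rwa [ProbabilityTheory.beta_eq_betaIntegralReal x y hx hy, ← h, Complex.ofReal_re] at h'

theorem ascPochhammer_eval_mul_add (q : ℝ) (n : ℕ) :
    (ascPochhammer ℝ n).eval q * (q + n) = q * (ascPochhammer ℝ n).eval (q + 1) := by
  induction n with
  | zero => simp
  | succ n ih =>
    rw [ascPochhammer_succ_eval, ascPochhammer_succ_eval, ih]
    push_cast
    ring

theorem factorial_le_ascPochhammer_eval {p : ℝ} (hp : 1 ≤ p) (n : ℕ) :
    (n.factorial : ℝ) ≤ (ascPochhammer ℝ n).eval p := by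
  induction n with
  | zero => simp
  | succ n ih =>
    rw [ascPochhammer_succ_eval, Nat.factorial_succ, mul_comm]
    push_cast
    exact mul_le_mul ih (by linarith) (by positivity) ((Nat.cast_nonneg _).trans ih)

theorem ascPochhammer_eval_le_factorial_succ {p : ℝ} (hp₀ : 0 < p) (hp : p ≤ 2) (n : ℕ) :
    (ascPochhammer ℝ n).eval p ≤ (n + 1) * n.factorial := by
  induction n with
  | zero => simp
  | succ n ih =>
    rw [ascPochhammer_succ_eval, Nat.factorial_succ]
    calc (ascPochhammer ℝ n).eval p * (p + n)
        ≤ ((n + 1) * n.factorial) * (2 + n) := by gcongr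
      _ = _ := by push_cast; ring

/-- When `r = q + 1`, the coefficients of the hypergeometric series simplify. -/
theorem hyp_coeff_eq {q : ℝ} (hq : 0 < q) (p : ℝ) (n : ℕ) :
    ((ascPochhammer ℝ n).eval p * (ascPochhammer ℝ n).eval q) /
      ((ascPochhammer ℝ n).eval (q + 1) * (n.factorial : ℝ)) =
    (ascPochhammer ℝ n).eval p / n.factorial * (q / (q + n)) := by
  have h₁ : 0 < (ascPochhammer ℝ n).eval (q + 1) := ascPochhammer_pos n _ (by positivity)
  have h₂ : q + n ≠ 0 := by positivity
  have h₃ := ascPochhammer_eval_mul_add q n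
  field_simp
  linear_combination (ascPochhammer ℝ n).eval p * h₃

theorem le_hyp_coeff {p q : ℝ} (hp : 1 ≤ p) (hq : 0 < q) (n : ℕ) :
    q / (q + 1) * (1 / ((n : ℝ) + 1)) ≤
      ((ascPochhammer ℝ n).eval p * (ascPochhammer ℝ n).eval q) /
        ((ascPochhammer ℝ n).eval (q + 1) * (n.factorial : ℝ)) := by
  rw [hyp_coeff_eq hq]
  have h₁ : 1 ≤ (ascPochhammer ℝ n).eval p / n.factorial := by
    rw [one_le_div (by positivity)]
    exact factorial_le_ascPochhammer_eval hp n
  have h₂ : q / (q + 1) * (1 / ((n : ℝ) + 1)) ≤ q / (q + n) := by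
    rw [div_mul_div_comm, mul_one]
    have : 0 ≤ q * n := by positivity
    gcongr
    nlinarith
  exact h₂.trans (le_mul_of_one_le_left (by positivity) h₁)

theorem hyp_coeff_nonneg {p q : ℝ} (hp : 1 ≤ p) (hq : 0 < q) (n : ℕ) :
    0 ≤ ((ascPochhammer ℝ n).eval p * (ascPochhammer ℝ n).eval q) /
      ((ascPochhammer ℝ n).eval (q + 1) * (n.factorial : ℝ)) :=
  le_trans (by positivity) (le_hyp_coeff hp hq n)

theorem hyp_coeff_le {p q : ℝ} (hp₀ : 0 < p) (hp : p ≤ 2) (hq : 0 < q) (n : ℕ) :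
    ((ascPochhammer ℝ n).eval p * (ascPochhammer ℝ n).eval q) /
      ((ascPochhammer ℝ n).eval (q + 1) * (n.factorial : ℝ)) ≤ n + 1 := by
  rw [hyp_coeff_eq hq]
  have h₁ : (ascPochhammer ℝ n).eval p / n.factorial ≤ n + 1 := by
    rw [div_le_iff₀ (by positivity)]
    exact ascPochhammer_eval_le_factorial_succ hp₀ hp n
  have h₂ : q / (q + n) ≤ 1 := by
    rw [div_le_one (by positivity)]
    simp
  exact (mul_le_of_le_one_right
    (div_nonneg (ascPochhammer_pos n p hp₀).le (by positivity)) h₂).trans h₁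

theorem hyp_nonneg {p q a : ℝ} (hp : 1 ≤ p) (hq : 0 < q) (ha : 0 ≤ a) :
    0 ≤ hyp p q (q + 1) a :=
  tsum_nonneg fun n ↦ mul_nonneg (hyp_coeff_nonneg hp hq n) (pow_nonneg ha n)

theorem summable_hyp {p q a : ℝ} (hp₁ : 1 ≤ p) (hp₂ : p ≤ 2) (hq : 0 < q) (ha₀ : 0 ≤ a)
    (ha₁ : a < 1) :
    Summable fun n : ℕ ↦ ((ascPochhammer ℝ n).eval p * (ascPochhammer ℝ n).eval q) /
      ((ascPochhammer ℝ n).eval (q + 1) * (n.factorial : ℝ)) * a ^ n := by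
  have ha : ‖a‖ < 1 := by rwa [Real.norm_of_nonneg ha₀]
  have h := (summable_pow_mul_geometric_of_norm_lt_one 1 ha).add
    (summable_geometric_of_norm_lt_one ha)
  refine h.of_nonneg_of_le
    (fun n ↦ mul_nonneg (hyp_coeff_nonneg hp₁ hq n) (pow_nonneg ha₀ n)) fun n ↦ ?_
  rw [pow_one, ← add_one_mul]
  gcongr
  exact hyp_coeff_le (by linarith) hp₂ hq n

theorem tendsto_hyp_atTop {p q : ℝ} (hp₁ : 1 ≤ p) (hp₂ : p ≤ 2) (hq : 0 < q) :
    Tendsto (hyp p q (q + 1)) (nhdsWithin 1 (Set.Ioo (0 : ℝ) 1)) atTop := by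
  refine tendsto_atTop.2 fun b ↦ ?_
  let c : ℕ → ℝ := fun n ↦ ((ascPochhammer ℝ n).eval p * (ascPochhammer ℝ n).eval q) /
    ((ascPochhammer ℝ n).eval (q + 1) * (n.factorial : ℝ))
  have hsum : Tendsto (fun N ↦ ∑ n ∈ Finset.range N, c n) atTop atTop := by
    refine tendsto_atTop_mono (fun N ↦ ?_)
      (tendsto_sum_range_one_div_nat_succ_atTop.const_mul_atTop (r := q / (q + 1)) (by positivity))
    rw [Finset.mul_sum]
    exact Finset.sum_le_sum fun n _ ↦ le_hyp_coeff hp₁ hq n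
  obtain ⟨N, hN⟩ := (hsum.eventually_gt_atTop b).exists
  have hcont : Continuous fun a : ℝ ↦ ∑ n ∈ Finset.range N, c n * a ^ n := by fun_prop
  have hlim := hcont.continuousWithinAt (s := Set.Ioo (0 : ℝ) 1) (x := 1)
  have hev := hlim.eventually_const_lt (u := b) (by simpa using hN)
  filter_upwards [hev, self_mem_nhdsWithin] with a ha ha'
  exact ha.le.trans ((summable_hyp hp₁ hp₂ hq ha'.1.le ha'.2).sum_le_tsum _
    fun n _ ↦ mul_nonneg (hyp_coeff_nonneg hp₁ hq n) (pow_nonneg ha'.1.le n))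

/-- `lim_{a→0⁺} R(a) = ∞` and `lim_{a→1⁻} R(a) = ∞`. -/
theorem Rf_tendsto_atTop (α : ℝ) (hα : α ∈ Set.Ioo (0:ℝ) 2) :
    Tendsto (Rf α) (nhdsWithin 0 (Set.Ioo (0:ℝ) 1)) atTop ∧
    Tendsto (Rf α) (nhdsWithin 1 (Set.Ioo (0:ℝ) 1)) atTop := by
  obtain ⟨h₀, h₂⟩ := hα
  have hC : 0 < Cc α :=
    div_pos (Real.sin_pos_of_pos_of_lt_pi (by positivity) (by nlinarith [Real.pi_pos])) Real.pi_pos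
  have hT : 0 < Tc α := betaFn_pos h₀ (by linarith)
  have hp₁ : 1 ≤ α / 2 + 1 := by linarith
  have hp₂ : α / 2 + 1 ≤ 2 := by linarith
  constructor
  · have hpow : Tendsto (fun a : ℝ ↦ a ^ (-(α / 2))) (nhdsWithin 0 (Set.Ioo (0:ℝ) 1)) atTop :=
      (tendsto_rpow_neg_nhdsGT_zero (by linarith)).mono_left
        (nhdsWithin_mono _ Set.Ioo_subset_Ioi_self)
    refine tendsto_atTop_mono' _ ?_ ((hpow.const_mul_atTop hT).const_mul_atTop hC)
    filter_upwards [self_mem_nhdsWithin] with a ha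
    refine mul_le_mul_of_nonneg_left (le_add_of_nonneg_right ?_) hC.le
    have := hyp_nonneg hp₁ h₀ ha.1.le
    have := ha.1.le
    positivity
  · have hpow : Tendsto (fun a : ℝ ↦ α⁻¹ * a ^ (α / 2)) (nhdsWithin 1 (Set.Ioo (0:ℝ) 1))
        (nhds α⁻¹) := by
      have : ContinuousAt (fun a : ℝ ↦ α⁻¹ * a ^ (α / 2)) 1 :=
        continuousAt_const.mul (Real.continuousAt_rpow_const _ _ (Or.inl one_ne_zero))
      simpa using this.tendsto.mono_left nhdsWithin_le_nhds
    refine tendsto_atTop_mono' _ ?_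
      ((hpow.pos_mul_atTop (inv_pos.2 h₀) (tendsto_hyp_atTop hp₁ hp₂ h₀)).const_mul_atTop hC)
    filter_upwards [self_mem_nhdsWithin] with a ha
    refine mul_le_mul_of_nonneg_left (le_add_of_nonneg_left ?_) hC.le
    have := ha.1.le
    positivity
end

section
/- Let α ∈ (0,2) and a ∈ (0,1). Then the limit lim_{h→0⁺} h^{-α/2} ( 1 - f_a(a+h) ) exists and equals Ψ(a) = C_α (1-a)^{α/2} ( ∫_1^∞ Φ(a,y) dy + ∫_a^∞ Φ(a,-y) dy - ∫_a^1 Φ(a,-y) f_a(y) dy ), where Φ(a,y) = ((y-a)(y-1))^{-α/2} |y-a|^{-1}. Moreover Ψ(a) ∈ (0,∞) for every a ∈ (0,1), and the function a ↦ Ψ(a) is continuous on (0,1). -/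
open MeasureTheory Real Filter Set

/-- Poisson kernel of the fractional Laplacian for the interval `(a,1)`:
`P_{(a,1)}(x,y) = C_α (((x-a)(1-x))/((y-a)(y-1)))^(α/2) |x-y|⁻¹`. -/
noncomputable def Pker (α a x y : ℝ) : ℝ :=
  Cc α * (((x - a) * (1 - x)) / ((y - a) * (y - 1))) ^ (α / 2) * |x - y|⁻¹

/-- `fseq α a n` is `f_a^{(n+1)}`: `f_a^{(1)}(x) = ∫_{-a}^a P_{(a,1)}(x,y) dy` and
`f_a^{(n)}(x) = ∫_a^1 P_{(a,1)}(x,-y) f_a^{(n-1)}(y) dy` for `n ≥ 2`. -/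
noncomputable def fseq (α a : ℝ) : ℕ → ℝ → ℝ
  | 0 => fun x => ∫ y in (-a)..a, Pker α a x y
  | n + 1 => fun x => ∫ y in a..(1:ℝ), Pker α a x (-y) * fseq α a n y

/-- `f_a(x) = Σ_{n=1}^∞ f_a^{(n)}(x)`. -/
noncomputable def ff (α a x : ℝ) : ℝ := ∑' n : ℕ, fseq α a n x

/-- `Φ(a,y) = ((y-a)(y-1))^(-α/2) |y-a|⁻¹`. -/
noncomputable def Phi (α a y : ℝ) : ℝ :=
  ((y - a) * (y - 1)) ^ (-(α / 2)) * |y - a|⁻¹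

/-- `Ψ(a) = C_α (1-a)^(α/2) (∫_1^∞ Φ(a,y) dy + ∫_a^∞ Φ(a,-y) dy - ∫_a^1 Φ(a,-y) f_a(y) dy)`. -/
noncomputable def Psi (α a : ℝ) : ℝ :=
  Cc α * (1 - a) ^ (α / 2) *
    ((∫ y in Set.Ioi (1:ℝ), Phi α a y) + (∫ y in Set.Ioi a, Phi α a (-y))
      - ∫ y in a..(1:ℝ), Phi α a (-y) * ff α a y)

/-- The Poisson kernel of `(a,1)` without its normalising constant and the factor depending only
on the starting point `x`, written with `β = α / 2`. -/
noncomputable def Qker (β a x y : ℝ) : ℝ := ((y - a) * (y - 1)) ^ (-β) * |x - y|⁻¹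

lemma integrableOn_beta_reflection {β : ℝ} (hβ : β ∈ Ioo (0:ℝ) 1) :
    IntegrableOn (fun s : ℝ => s ^ (-β) * (1 - s) ^ (β - 1)) (Ioo 0 1) ∧
      ∫ s in Ioo (0:ℝ) 1, s ^ (-β) * (1 - s) ^ (β - 1) = π / sin (π * β) := by
  have hre : ∀ s ∈ Ioo (0:ℝ) 1,
      RCLike.re ((s : ℂ) ^ (((1 - β : ℝ) : ℂ) - 1) * (1 - (s : ℂ)) ^ ((β : ℂ) - 1)) =
        s ^ (-β) * (1 - s) ^ (β - 1) := by
    intro s hs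
    have h1 : (s : ℂ) ^ (((1 - β : ℝ) : ℂ) - 1) = ((s ^ (-β) : ℝ) : ℂ) := by
      rw [Complex.ofReal_cpow hs.1.le]; push_cast; ring_nf
    have h2 : (1 - (s : ℂ)) ^ ((β : ℂ) - 1) = (((1 - s) ^ (β - 1) : ℝ) : ℂ) := by
      rw [Complex.ofReal_cpow (by linarith [hs.2])]; push_cast; ring_nf
    rw [h1, h2, ← Complex.ofReal_mul]
    exact Complex.ofReal_re _
  have hint := (Complex.betaIntegral_convergent (u := ((1 - β : ℝ) : ℂ)) (v := (β : ℂ))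
    (by simpa using hβ.2) (by simpa using hβ.1)).1.mono_set Ioo_subset_Ioc_self
  refine ⟨IntegrableOn.congr_fun hint.re hre measurableSet_Ioo, ?_⟩
  rw [← setIntegral_congr_fun measurableSet_Ioo hre, integral_re hint]
  have h := ProbabilityTheory.beta_eq_betaIntegralReal (1 - β) β (by linarith [hβ.2]) hβ.1
  rw [ProbabilityTheory.beta, sub_add_cancel, Real.Gamma_one, div_one, mul_comm,
    Real.Gamma_mul_Gamma_one_sub] at h
  rw [h, Complex.betaIntegral, intervalIntegral.integral_of_le zero_le_one,
    integral_Ioc_eq_integral_Ioo]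
  rfl

lemma Qker_reflect (β a x y : ℝ) : Qker β a x (1 + a - y) = Qker β a (1 + a - x) y := by
  have h1 : (1 + a - y - a) * (1 + a - y - 1) = (y - a) * (y - 1) := by ring
  have h2 : |x - (1 + a - y)| = |1 + a - x - y| := by rw [abs_sub_comm]; congr 1; ring
  rw [Qker, Qker, h1, h2]

lemma measurable_Qker (β a x : ℝ) : Measurable (Qker β a x) := by
  unfold Qker; fun_prop

lemma Qker_nonneg {β a x y : ℝ} (h : 0 ≤ (y - a) * (y - 1)) : 0 ≤ Qker β a x y := by
  unfold Qker; positivity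

lemma Qker_add_reflect {β a x : ℝ} (hx : x ∈ Ioo a 1) :
    EqOn (fun y => ((x - a) * (1 - x)) ^ β * (Qker β a x y + Qker β a x (1 + a - y)))
      (fun y => |(x - a) * (1 - x) * (2 * y - 1 - a) /
          ((y - a) * (y - 1) + (x - a) * (1 - x)) ^ 2| •
        (((y - a) * (y - 1) / ((y - a) * (y - 1) + (x - a) * (1 - x))) ^ (-β) *
          (1 - (y - a) * (y - 1) / ((y - a) * (y - 1) + (x - a) * (1 - x))) ^ (β - 1)))
      (Ioi 1) := by
  intro y hy
  have hy : 1 < y := hy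
  obtain ⟨hx0, hx1⟩ := hx
  have hw : 0 < (x - a) * (1 - x) := mul_pos (by linarith) (by linarith)
  have hu : 0 < (y - a) * (y - 1) := mul_pos (by linarith) (by linarith)
  have e : (y - x) * (y - (1 + a - x)) = (y - a) * (y - 1) + (x - a) * (1 - x) := by ring
  have hs : (y - x)⁻¹ + (y - (1 + a - x))⁻¹ =
      (2 * y - 1 - a) / ((y - a) * (y - 1) + (x - a) * (1 - x)) := by
    rw [← e, inv_add_inv (by linarith) (by linarith)]; congr 1; ring
  have e1 : |x - y| = y - x := by rw [abs_sub_comm, abs_of_pos (by linarith)]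
  have e2 : |1 + a - x - y| = y - (1 + a - x) := by rw [abs_sub_comm, abs_of_pos (by linarith)]
  simp only [Qker_reflect, smul_eq_mul]
  simp only [Qker, e1, e2, ← mul_add, hs]
  generalize (x - a) * (1 - x) = w at *
  generalize (y - a) * (y - 1) = u at *
  have hv : 0 < u + w := by linarith
  have hn : 0 < 2 * y - 1 - a := by linarith
  have e3 : 1 - u / (u + w) = w / (u + w) := by field_simp; ring
  rw [e3, abs_of_pos (by positivity), div_rpow hu.le hv.le, div_rpow hw.le hv.le,
    rpow_sub_one hw.ne', rpow_sub_one hv.ne', rpow_neg hu.le, rpow_neg hv.le]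
  have := (rpow_pos_of_pos hu β).ne'
  have := (rpow_pos_of_pos hv β).ne'
  field_simp

lemma image_div_add_Ioi {a w : ℝ} (ha : a < 1) (hw : 0 < w) :
    (fun y : ℝ => (y - a) * (y - 1) / ((y - a) * (y - 1) + w)) '' Ioi 1 = Ioo 0 1 := by
  ext s
  constructor
  · rintro ⟨y, hy, rfl⟩
    have hu : 0 < (y - a) * (y - 1) := mul_pos (by linarith [mem_Ioi.1 hy]) (sub_pos.2 hy)
    exact ⟨by positivity, by rw [div_lt_one (by positivity)]; linarith⟩
  · rintro ⟨h0, h1⟩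
    have hs : 0 < 1 - s := by linarith
    obtain ⟨c, hc⟩ : ∃ c, c = w * s / (1 - s) := ⟨_, rfl⟩
    have hc0 : 0 < c := by rw [hc]; positivity
    have hsq := Real.sq_sqrt (show 0 ≤ ((1 - a) / 2) ^ 2 + c by positivity)
    have hlt : (1 - a) / 2 < √(((1 - a) / 2) ^ 2 + c) :=
      Real.lt_sqrt_of_sq_lt (by linarith)
    refine ⟨(1 + a) / 2 + √(((1 - a) / 2) ^ 2 + c), by rw [mem_Ioi]; linarith, ?_⟩
    have : ((1 + a) / 2 + √(((1 - a) / 2) ^ 2 + c) - a) *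
        ((1 + a) / 2 + √(((1 - a) / 2) ^ 2 + c) - 1) = c := by nlinarith
    simp only [this]
    rw [hc]
    field_simp
    ring

lemma injOn_div_add_Ioi {a w : ℝ} (ha : a < 1) (hw : 0 < w) :
    InjOn (fun y : ℝ => (y - a) * (y - 1) / ((y - a) * (y - 1) + w)) (Ioi 1) := by
  intro y hy z hz h
  have hy : 1 < y := hy
  have hz : 1 < z := hz
  have hu : 0 < (y - a) * (y - 1) := mul_pos (by linarith) (by linarith)
  have hv : 0 < (z - a) * (z - 1) := mul_pos (by linarith) (by linarith)
  simp only at h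
  rw [div_eq_div_iff (by positivity) (by positivity)] at h
  have h2 : (y - a) * (y - 1) = (z - a) * (z - 1) := by
    apply mul_right_cancel₀ hw.ne'; linarith
  have h3 : (y - z) * (y + z - 1 - a) = 0 := by linear_combination h2
  rcases mul_eq_zero.1 h3 with h | h <;> linarith

lemma integral_Qker_add_reflect {β a x : ℝ} (hβ : β ∈ Ioo (0:ℝ) 1) (hx : x ∈ Ioo a 1) :
    IntegrableOn (fun y => Qker β a x y + Qker β a x (1 + a - y)) (Ioi 1) ∧
      ((x - a) * (1 - x)) ^ β * ∫ y in Ioi 1, (Qker β a x y + Qker β a x (1 + a - y)) =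
        π / sin (π * β) := by
  have ha : a < 1 := hx.1.trans hx.2
  have hw : 0 < (x - a) * (1 - x) := mul_pos (by linarith [hx.1]) (by linarith [hx.2])
  have hd : ∀ y ∈ Ioi (1:ℝ), HasDerivWithinAt
      (fun y : ℝ => (y - a) * (y - 1) / ((y - a) * (y - 1) + (x - a) * (1 - x)))
      ((x - a) * (1 - x) * (2 * y - 1 - a) / ((y - a) * (y - 1) + (x - a) * (1 - x)) ^ 2)
      (Ioi 1) y := by
    intro y hy
    have hu : 0 < (y - a) * (y - 1) := mul_pos (by linarith [mem_Ioi.1 hy]) (sub_pos.2 hy)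
    have h1 : HasDerivAt (fun y : ℝ => (y - a) * (y - 1)) (1 * (y - 1) + (y - a) * 1) y :=
      ((hasDerivAt_id y).sub_const a).mul ((hasDerivAt_id y).sub_const 1)
    have h2 := h1.div (h1.add_const ((x - a) * (1 - x))) (by positivity)
    refine (h2.congr_deriv ?_).hasDerivWithinAt
    congr 1; ring
  obtain ⟨b1, b2⟩ := integrableOn_beta_reflection hβ
  rw [← image_div_add_Ioi ha hw] at b1 b2
  rw [integrableOn_image_iff_integrableOn_abs_deriv_smul measurableSet_Ioi hd
    (injOn_div_add_Ioi ha hw)] at b1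
  rw [integral_image_eq_integral_abs_deriv_smul measurableSet_Ioi hd
    (injOn_div_add_Ioi ha hw)] at b2
  constructor
  · have h := IntegrableOn.congr_fun b1 (Qker_add_reflect hx).symm measurableSet_Ioi
    exact (integrable_const_mul_iff (rpow_pos_of_pos hw β).ne'.isUnit _).1 h
  · rw [← b2, ← integral_const_mul]
    exact setIntegral_congr_fun measurableSet_Ioi (Qker_add_reflect hx)

lemma integrableOn_Qker_Ioi {β a x : ℝ} (hβ : β ∈ Ioo (0:ℝ) 1) (hx : x ∈ Ioo a 1) :
    IntegrableOn (Qker β a x) (Ioi 1) := by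
  refine (integral_Qker_add_reflect hβ hx).1.mono' (measurable_Qker _ _ _).aestronglyMeasurable ?_
  filter_upwards [ae_restrict_mem measurableSet_Ioi] with y hy
  have hu : 0 < (y - a) * (y - 1) :=
    mul_pos (by linarith [mem_Ioi.1 hy, hx.1, hx.2]) (sub_pos.2 hy)
  have h1 : 0 ≤ Qker β a x y := Qker_nonneg hu.le
  have h2 : 0 ≤ Qker β a x (1 + a - y) := by rw [Qker_reflect]; exact Qker_nonneg hu.le
  rw [norm_of_nonneg h1]; linarith

lemma integrableOn_Qker_reflect {β a x : ℝ} (hβ : β ∈ Ioo (0:ℝ) 1) (hx : x ∈ Ioo a 1) :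
    IntegrableOn (fun y => Qker β a x (1 + a - y)) (Ioi 1) := by
  simp only [Qker_reflect]
  exact integrableOn_Qker_Ioi hβ ⟨by linarith [hx.2], by linarith [hx.1]⟩

lemma integrableOn_Qker_Iio {β a x : ℝ} (hβ : β ∈ Ioo (0:ℝ) 1) (hx : x ∈ Ioo a 1) :
    IntegrableOn (Qker β a x) (Iio a) := by
  have h := (MeasurePreserving.integrableOn_comp_preimage
    (Measure.measurePreserving_sub_left volume (1 + a))
    (Homeomorph.subLeft (1 + a)).measurableEmbedding (f := Qker β a x) (s := Iio a)).1
  refine h ?_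
  simpa [Function.comp_def] using integrableOn_Qker_reflect hβ hx

lemma integral_Qker {β a x : ℝ} (hβ : β ∈ Ioo (0:ℝ) 1) (hx : x ∈ Ioo a 1) :
    ((x - a) * (1 - x)) ^ β * ((∫ y in Ioi 1, Qker β a x y) + ∫ y in Iio a, Qker β a x y) =
        π / sin (π * β) := by
  have h := (Measure.measurePreserving_sub_left volume (1 + a)).setIntegral_preimage_emb
    (Homeomorph.subLeft (1 + a)).measurableEmbedding (Qker β a x) (Iio a)
  rw [← (integral_Qker_add_reflect hβ hx).2,
    integral_add (integrableOn_Qker_Ioi hβ hx) (integrableOn_Qker_reflect hβ hx), ← h]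
  simp

lemma Qker_le_Qker_of_one_lt {β a x c d y : ℝ} (hβ : 0 ≤ β) (hac : a ≤ c) (hc : c ≤ 1)
    (hxd : x ≤ d) (hd : d ≤ 1) (hy : 1 < y) : Qker β a x y ≤ Qker β c d y := by
  have h1 : |x - y| = y - x := by rw [abs_sub_comm, abs_of_pos (by linarith)]
  have h2 : |d - y| = y - d := by rw [abs_sub_comm, abs_of_pos (by linarith)]
  have h3 : 0 < (y - c) * (y - 1) := mul_pos (by linarith) (by linarith)
  have h4 : 0 < y - d := by linarith
  unfold Qker
  rw [h1, h2]
  refine mul_le_mul (rpow_le_rpow_of_nonpos h3 ?_ (by linarith)) ?_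
    (inv_nonneg.2 (by linarith)) (by positivity)
  · exact mul_le_mul_of_nonneg_right (by linarith) (by linarith)
  · exact inv_anti₀ h4 (by linarith)

lemma Qker_le_Qker_neg {β a x c d s : ℝ} (hβ : 0 ≤ β) (hc : 0 < c) (hca : c ≤ a)
    (hcd : 0 < c + d) (hd : c + d ≤ a + x) (hs : 0 ≤ s) :
    Qker β a x (-a - s) ≤ Qker β c d (-c - s) := by
  have h1 : |x - (-a - s)| = a + x + s := by rw [abs_of_pos (by linarith)]; ring
  have h2 : |d - (-c - s)| = c + d + s := by rw [abs_of_pos (by linarith)]; ring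
  have h3 : (-a - s - a) * (-a - s - 1) = (2 * a + s) * (1 + a + s) := by ring
  have h4 : (-c - s - c) * (-c - s - 1) = (2 * c + s) * (1 + c + s) := by ring
  unfold Qker
  rw [h1, h2, h3, h4]
  refine mul_le_mul (rpow_le_rpow_of_nonpos (by positivity) ?_ (by linarith)) ?_
    (inv_nonneg.2 (by linarith)) (by positivity)
  · exact mul_le_mul (by linarith) (by linarith) (by linarith) (by linarith)
  · exact inv_anti₀ (by linarith) (by linarith)

lemma integral_Ioi_comp_neg (f : ℝ → ℝ) (a : ℝ) :
    ∫ y in Ioi a, f (-y) = ∫ s in Ioi 0, f (-a - s) := by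
  have h := (Measure.measurePreserving_sub_left volume (-a)).setIntegral_preimage_emb
    (Homeomorph.subLeft (-a)).measurableEmbedding f (Iio (-a))
  rw [integral_comp_neg_Ioi, integral_Iic_eq_integral_Iio, ← h]
  simp

lemma integrableOn_Ioi_comp_neg (f : ℝ → ℝ) (a : ℝ) :
    IntegrableOn (fun y => f (-y)) (Ioi a) ↔ IntegrableOn f (Iio (-a)) := by
  have h := (Measure.measurePreserving_neg (volume : Measure ℝ)).integrableOn_comp_preimage
    (Homeomorph.neg ℝ).measurableEmbedding (f := f) (s := Iio (-a))
  simpa [Function.comp_def] using h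

lemma integrableOn_Ioi_comp_neg_sub (f : ℝ → ℝ) (a : ℝ) :
    IntegrableOn (fun s => f (-a - s)) (Ioi 0) ↔ IntegrableOn f (Iio (-a)) := by
  have h := (Measure.measurePreserving_sub_left volume (-a)).integrableOn_comp_preimage
    (Homeomorph.subLeft (-a)).measurableEmbedding (f := f) (s := Iio (-a))
  simpa [Function.comp_def] using h

lemma integrableOn_Qker_neg_sub {β a x : ℝ} (hβ : β ∈ Ioo (0:ℝ) 1) (ha : 0 < a)
    (hx : x ∈ Ioo a 1) : IntegrableOn (fun s => Qker β a x (-a - s)) (Ioi 0) :=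
  (integrableOn_Ioi_comp_neg_sub _ _).2
    ((integrableOn_Qker_Iio hβ hx).mono_set (Iio_subset_Iio (by linarith)))

lemma Qker_neg_nonneg {β a x y : ℝ} (ha : 0 < a) (hy : a ≤ y) : 0 ≤ Qker β a x (-y) :=
  Qker_nonneg (by nlinarith)

lemma Qker_nonneg_of_one_lt {β a x y : ℝ} (ha : a ≤ 1) (hy : 1 < y) : 0 ≤ Qker β a x y :=
  Qker_nonneg (mul_nonneg (by linarith) (by linarith))

lemma integrableOn_Qker_Ioi' {β a x : ℝ} (hβ : β ∈ Ioo (0:ℝ) 1) (hx : x ∈ Ico a 1) :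
    IntegrableOn (Qker β a x) (Ioi 1) := by
  have hc : (1 + x) / 2 ∈ Ioo x 1 := ⟨by linarith [hx.2], by linarith [hx.2]⟩
  refine (integrableOn_Qker_Ioi hβ hc).mono' (measurable_Qker _ _ _).aestronglyMeasurable ?_
  filter_upwards [ae_restrict_mem measurableSet_Ioi] with y hy
  rw [norm_of_nonneg (Qker_nonneg_of_one_lt (hx.1.trans hx.2.le) hy)]
  exact Qker_le_Qker_of_one_lt hβ.1.le hx.1 hx.2.le hc.1.le hc.2.le hy

lemma integrableOn_Qker_neg {β a x : ℝ} (hβ : β ∈ Ioo (0:ℝ) 1) (ha : 0 < a) (hx : x ∈ Ico a 1) :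
    IntegrableOn (fun y => Qker β a x (-y)) (Ioi a) := by
  rw [integrableOn_Ioi_comp_neg, ← integrableOn_Ioi_comp_neg_sub]
  obtain ⟨h0, h1⟩ := hx
  refine (integrableOn_Qker_neg_sub (a := a / 2) (x := 3 * a / 2 ⊓ (a + 1) / 2) hβ (by linarith)
    ⟨lt_inf_iff.2 ⟨by linarith, by linarith⟩, inf_lt_of_right_lt (by linarith)⟩).mono'
    ((measurable_Qker _ _ _).comp (measurable_id.const_sub _)).aestronglyMeasurable ?_
  filter_upwards [ae_restrict_mem measurableSet_Ioi] with s hs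
  have hs : 0 < s := hs
  rw [norm_of_nonneg (by
    rw [show -a - s = -(a + s) by ring]; exact Qker_neg_nonneg ha (by linarith))]
  refine Qker_le_Qker_neg hβ.1.le (by linarith) (by linarith) ?_ ?_ hs.le
  · have : 0 < 3 * a / 2 ⊓ (a + 1) / 2 := lt_inf_iff.2 ⟨by linarith, by linarith⟩
    linarith
  · have : 3 * a / 2 ⊓ (a + 1) / 2 ≤ 3 * a / 2 := inf_le_left
    linarith

lemma integral_Iio_Qker {β a x : ℝ} (hβ : β ∈ Ioo (0:ℝ) 1) (ha : 0 < a) (hx : x ∈ Ioo a 1) :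
    ∫ y in Iio a, Qker β a x y =
      (∫ y in Ioi a, Qker β a x (-y)) + ∫ y in Ioo (-a) a, Qker β a x y := by
  have hi := integrableOn_Qker_Iio hβ hx
  rw [integral_comp_neg_Ioi, ← setIntegral_union _ measurableSet_Ioo
    (hi.mono_set (Iic_subset_Iio.2 (by linarith))) (hi.mono_set Ioo_subset_Iio_self),
    Iic_union_Ioo_eq_Iio (by linarith)]
  exact (Iic_disjoint_Ioi le_rfl).mono_right Ioo_subset_Ioi_self

lemma Cc_pos {α : ℝ} (hα : α ∈ Ioo (0:ℝ) 2) : 0 < Cc α :=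
  div_pos (sin_pos_of_pos_of_lt_pi (by have := hα.1; positivity)
    (by nlinarith [hα.2, pi_pos])) pi_pos

lemma Cc_mul_pi_div_sin {α : ℝ} (hα : α ∈ Ioo (0:ℝ) 2) :
    Cc α * (π / sin (π * (α / 2))) = 1 := by
  have h := (Cc_pos hα).ne'
  unfold Cc at *
  rw [← mul_div_assoc]
  have : sin (π * α / 2) ≠ 0 := fun h' => h (by rw [h', zero_div])
  field_simp

lemma Pker_eq {α a x y : ℝ} (hx : 0 ≤ (x - a) * (1 - x)) (hy : 0 ≤ (y - a) * (y - 1)) :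
    Pker α a x y = Cc α * ((x - a) * (1 - x)) ^ (α / 2) * Qker (α / 2) a x y := by
  rw [Pker, Qker, div_rpow hx hy, rpow_neg hy, div_eq_mul_inv]; ring

/-- The part of the Poisson kernel of `(a,1)` depending only on the starting point. -/
noncomputable def startFactor (α a x : ℝ) : ℝ := Cc α * ((x - a) * (1 - x)) ^ (α / 2)

lemma startFactor_pos {α a x : ℝ} (hα : α ∈ Ioo (0:ℝ) 2) (hx : x ∈ Ioo a 1) :
    0 < startFactor α a x :=
  mul_pos (Cc_pos hα) (rpow_pos_of_pos (mul_pos (by linarith [hx.1]) (by linarith [hx.2])) _)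

lemma half_mem_Ioo {α : ℝ} (hα : α ∈ Ioo (0:ℝ) 2) : α / 2 ∈ Ioo (0:ℝ) 1 :=
  ⟨by linarith [hα.1], by linarith [hα.2]⟩

lemma fseq_zero_nonneg {α a x : ℝ} (hα : α ∈ Ioo (0:ℝ) 2) (ha : a ∈ Ioo (0:ℝ) 1)
    (hx : x ∈ Ioo a 1) : 0 ≤ fseq α a 0 x := by
  have hw : 0 ≤ (x - a) * (1 - x) := mul_nonneg (by linarith [hx.1]) (by linarith [hx.2])
  refine intervalIntegral.integral_nonneg (by linarith [ha.1]) fun y hy => ?_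
  have hy' : 0 ≤ (y - a) * (y - 1) := by nlinarith [hy.2, ha.2]
  rw [Pker_eq hw hy']
  exact mul_nonneg (startFactor_pos hα hx).le (Qker_nonneg hy')

lemma fseq_zero_eq {α a x : ℝ} (hα : α ∈ Ioo (0:ℝ) 2) (ha : a ∈ Ioo (0:ℝ) 1)
    (hx : x ∈ Ioo a 1) : fseq α a 0 x = 1 - startFactor α a x *
      ((∫ y in Ioi 1, Qker (α / 2) a x y) + ∫ y in Ioi a, Qker (α / 2) a x (-y)) := by
  have hw : 0 ≤ (x - a) * (1 - x) := mul_nonneg (by linarith [hx.1]) (by linarith [hx.2])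
  have h0 : fseq α a 0 x = startFactor α a x * ∫ y in Ioo (-a) a, Qker (α / 2) a x y := by
    rw [show fseq α a 0 x = ∫ y in (-a)..a, Pker α a x y from rfl, intervalIntegral.integral_of_le (by linarith [ha.1]),
      integral_Ioc_eq_integral_Ioo, ← integral_const_mul]
    refine setIntegral_congr_fun measurableSet_Ioo fun y hy => Pker_eq hw ?_
    nlinarith [hy.2, ha.2]
  have h := Cc_mul_pi_div_sin hα
  rw [← integral_Qker (half_mem_Ioo hα) hx, integral_Iio_Qker (half_mem_Ioo hα) ha.1 hx] at h
  rw [h0, startFactor]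
  linear_combination h

lemma fseq_succ_eq {α a x : ℝ} (ha : a ∈ Ioo (0:ℝ) 1) (hx : x ∈ Ioo a 1) (n : ℕ) :
    fseq α a (n + 1) x =
      startFactor α a x * ∫ y in Ioo a 1, Qker (α / 2) a x (-y) * fseq α a n y := by
  have hw : 0 ≤ (x - a) * (1 - x) := mul_nonneg (by linarith [hx.1]) (by linarith [hx.2])
  rw [show fseq α a (n + 1) x = ∫ y in a..1, Pker α a x (-y) * fseq α a n y from rfl,
    intervalIntegral.integral_of_le ha.2.le, integral_Ioc_eq_integral_Ioo,
    ← integral_const_mul]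
  refine setIntegral_congr_fun measurableSet_Ioo fun y hy => ?_
  have : 0 ≤ (-y - a) * (-y - 1) := by nlinarith [hy.1, ha.1]
  simp only [Pker_eq hw this, startFactor]
  ring

/-- A bound for the mass that the Poisson kernel of `(a,1)` gives to `(-1,-a)`. -/
noncomputable def escapeBound (α a : ℝ) : ℝ := (1 + a ^ (α / 2 + 1))⁻¹

lemma escapeBound_pos {α a : ℝ} (ha : 0 < a) : 0 < escapeBound α a := by
  unfold escapeBound; positivity

lemma escapeBound_lt_one {α a : ℝ} (ha : 0 < a) : escapeBound α a < 1 :=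
  inv_lt_one_of_one_lt₀ (by have := rpow_pos_of_pos ha (α / 2 + 1); linarith)

lemma escapeBound_anti {α a c : ℝ} (hα : 0 < α) (hc : 0 < c) (hca : c ≤ a) :
    escapeBound α a ≤ escapeBound α c :=
  inv_anti₀ (by positivity) (by
    gcongr)

lemma Qker_neg_le_const {β a x y : ℝ} (hβ : 0 < β) (ha : 0 < a) (hx : a ≤ x) (hy : a ≤ y) :
    Qker β a x (-y) ≤ (2 * a) ^ (-(β + 1)) := by
  have h1 : |x - -y| = x + y := by rw [abs_of_pos (by linarith)]; ring
  have h2 : (-y - a) * (-y - 1) = (y + a) * (y + 1) := by ring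
  rw [Qker, h1, h2, neg_add, rpow_add (by positivity), rpow_neg_one]
  refine mul_le_mul (rpow_le_rpow_of_nonpos (by positivity) (by nlinarith) (by linarith)) ?_
    (inv_nonneg.2 (by linarith)) (by positivity)
  exact inv_anti₀ (by linarith) (by linarith)

lemma le_integral_Qker_Ioi {β a x : ℝ} (hβ : β ∈ Ioo (0:ℝ) 1) (ha : 0 < a) (hx : x ∈ Ico a 1) :
    (2:ℝ) ^ (-(β + 1)) ≤ ∫ y in Ioi 1, Qker β a x y := by
  have hi := integrableOn_Qker_Ioi' hβ hx
  have ha1 : a < 1 := hx.1.trans_lt hx.2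
  calc (2:ℝ) ^ (-(β + 1)) = ∫ y in Ioo (1:ℝ) 2, (2:ℝ) ^ (-(β + 1)) := by norm_num
    _ ≤ ∫ y in Ioo (1:ℝ) 2, Qker β a x y := by
      refine setIntegral_mono_on (by simp) (hi.mono_set Ioo_subset_Ioi_self)
        measurableSet_Ioo fun y hy => ?_
      obtain ⟨h1, h2⟩ := hy
      have h3 : |x - y| = y - x := by rw [abs_sub_comm, abs_of_pos (by linarith [hx.2])]
      rw [Qker, h3, neg_add, rpow_add (by positivity), rpow_neg_one]
      have h4 : 0 < (y - a) * (y - 1) := mul_pos (by linarith) (by linarith)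
      refine mul_le_mul (rpow_le_rpow_of_nonpos h4 (by nlinarith) (by linarith [hβ.1])) ?_
        (by positivity) (by positivity)
      exact inv_anti₀ (by linarith [hx.2]) (by linarith [hx.1])
    _ ≤ _ := by
      refine setIntegral_mono_set hi ?_ Ioo_subset_Ioi_self.eventuallyLE
      filter_upwards [ae_restrict_mem measurableSet_Ioi] with y hy
      exact Qker_nonneg_of_one_lt ha1.le hy

lemma integral_Ioo_Qker_neg_le {β a x : ℝ} (hβ : β ∈ Ioo (0:ℝ) 1) (ha : 0 < a)
    (hx : x ∈ Ico a 1) :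
    ∫ y in Ioo a 1, Qker β a x (-y) ≤ ∫ y in Ioi a, Qker β a x (-y) := by
  refine setIntegral_mono_set (integrableOn_Qker_neg hβ ha hx) ?_
    Ioo_subset_Ioi_self.eventuallyLE
  filter_upwards [ae_restrict_mem measurableSet_Ioi] with y hy
  exact Qker_neg_nonneg ha (le_of_lt hy)

lemma startFactor_mul_integral_add_le {α a x : ℝ} (hα : α ∈ Ioo (0:ℝ) 2) (ha : a ∈ Ioo (0:ℝ) 1)
    (hx : x ∈ Ioo a 1) : startFactor α a x *
      ((∫ y in Ioi 1, Qker (α / 2) a x y) + ∫ y in Ioo a 1, Qker (α / 2) a x (-y)) ≤ 1 := by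
  have h1 := fseq_zero_nonneg hα ha hx
  rw [fseq_zero_eq hα ha hx] at h1
  have h2 := integral_Ioo_Qker_neg_le (half_mem_Ioo hα) ha.1 (Ioo_subset_Ico_self hx)
  have h3 := startFactor_pos hα hx
  nlinarith

lemma startFactor_mul_integral_le {α a x : ℝ} (hα : α ∈ Ioo (0:ℝ) 2) (ha : a ∈ Ioo (0:ℝ) 1)
    (hx : x ∈ Ioo a 1) :
    startFactor α a x * (∫ y in Ioo a 1, Qker (α / 2) a x (-y)) ≤ escapeBound α a := by
  have h0 := startFactor_pos hα hx
  have h1 := startFactor_mul_integral_add_le hα ha hx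
  have hβ := half_mem_Ioo hα
  have h2 := le_integral_Qker_Ioi hβ ha.1 (Ioo_subset_Ico_self hx)
  have h3 : ∫ y in Ioo a 1, Qker (α / 2) a x (-y) ≤ (2 * a) ^ (-(α / 2 + 1)) := by
    calc _ ≤ ∫ y in Ioo a 1, (2 * a) ^ (-(α / 2 + 1)) :=
          setIntegral_mono_on ((integrableOn_Qker_neg hβ ha.1
            (Ioo_subset_Ico_self hx)).mono_set Ioo_subset_Ioi_self) (by simp) measurableSet_Ioo
            fun y hy => Qker_neg_le_const hβ.1 ha.1 hx.1.le hy.1.le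
      _ = (1 - a) * (2 * a) ^ (-(α / 2 + 1)) := by simp [ha.2.le]
      _ ≤ _ := mul_le_of_le_one_left (rpow_nonneg (by linarith [ha.1]) _) (by linarith [ha.1])
  have h4 : (2 * a) ^ (-(α / 2 + 1)) * a ^ (α / 2 + 1) = 2 ^ (-(α / 2 + 1)) := by
    have := rpow_pos_of_pos ha.1 (α / 2 + 1)
    rw [mul_rpow zero_le_two ha.1.le, mul_assoc, ← rpow_add ha.1]; simp
  have h5 := rpow_pos_of_pos ha.1 (α / 2 + 1)
  rw [escapeBound, ← one_div, le_div_iff₀ (by positivity)]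
  have h6 := mul_le_mul_of_nonneg_right h3 h5.le
  rw [h4] at h6
  calc _ = startFactor α a x * ((∫ y in Ioo a 1, Qker (α / 2) a x (-y)) * a ^ (α / 2 + 1) +
        ∫ y in Ioo a 1, Qker (α / 2) a x (-y)) := by ring
    _ ≤ _ := by gcongr; linarith
    _ ≤ 1 := h1

lemma measurable_fseq (α a : ℝ) (n : ℕ) : Measurable (fseq α a n) := by
  have key : ∀ (g : ℝ → ℝ → ℝ), Measurable (Function.uncurry g) → ∀ b c : ℝ,
      Measurable fun x => ∫ y in b..c, g x y := fun g hg b c => by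
    simp only [intervalIntegral]
    exact (hg.stronglyMeasurable.integral_prod_right.sub
      hg.stronglyMeasurable.integral_prod_right).measurable
  induction n with
  | zero => exact key _ (by unfold Pker Function.uncurry; fun_prop) _ _
  | succ n ih => exact key _ (by unfold Pker Function.uncurry; fun_prop) _ _

lemma integrableOn_Qker_neg_mul {β a x : ℝ} {g : ℝ → ℝ} {C : ℝ} (hβ : β ∈ Ioo (0:ℝ) 1)
    (ha : 0 < a) (hx : x ∈ Ico a 1) (hg : Measurable g) (hC : ∀ y ∈ Ioo a 1, |g y| ≤ C) :
    IntegrableOn (fun y => Qker β a x (-y) * g y) (Ioo a 1) := by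
  refine Integrable.mul_bdd (c := C)
    ((integrableOn_Qker_neg hβ ha hx).mono_set Ioo_subset_Ioi_self) hg.aestronglyMeasurable ?_
  filter_upwards [ae_restrict_mem measurableSet_Ioo] with y hy using hC y hy

lemma integral_Qker_neg_mul_le {β a x : ℝ} {g : ℝ → ℝ} {C : ℝ} (hβ : β ∈ Ioo (0:ℝ) 1)
    (ha : 0 < a) (hx : x ∈ Ico a 1) (hg : Measurable g) (h0 : ∀ y ∈ Ioo a 1, 0 ≤ g y)
    (hC : ∀ y ∈ Ioo a 1, g y ≤ C) :
    ∫ y in Ioo a 1, Qker β a x (-y) * g y ≤ (∫ y in Ioo a 1, Qker β a x (-y)) * C := by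
  rw [← integral_mul_const]
  refine setIntegral_mono_on (integrableOn_Qker_neg_mul hβ ha hx hg
    fun y hy => (abs_of_nonneg (h0 y hy)).trans_le (hC y hy))
    (((integrableOn_Qker_neg hβ ha hx).mono_set Ioo_subset_Ioi_self).mul_const C)
    measurableSet_Ioo fun y hy => ?_
  exact mul_le_mul_of_nonneg_left (hC y hy) (Qker_neg_nonneg ha hy.1.le)

lemma fseq_mem_Icc {α a : ℝ} (hα : α ∈ Ioo (0:ℝ) 2) (ha : a ∈ Ioo (0:ℝ) 1) (n : ℕ) :
    ∀ x ∈ Ioo a 1, fseq α a n x ∈ Icc 0 (escapeBound α a ^ n) := by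
  have hβ := half_mem_Ioo hα
  induction n with
  | zero =>
    intro x hx
    refine ⟨fseq_zero_nonneg hα ha hx, ?_⟩
    rw [fseq_zero_eq hα ha hx, pow_zero, sub_le_self_iff]
    refine mul_nonneg (startFactor_pos hα hx).le (add_nonneg ?_ ?_)
    · exact setIntegral_nonneg measurableSet_Ioi fun y hy => Qker_nonneg_of_one_lt ha.2.le hy
    · exact setIntegral_nonneg measurableSet_Ioi fun y hy =>
        Qker_neg_nonneg ha.1 (le_of_lt hy)
  | succ n ih =>
    intro x hx
    have hw := startFactor_pos hα hx
    rw [fseq_succ_eq ha hx]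
    constructor
    · exact mul_nonneg hw.le (setIntegral_nonneg measurableSet_Ioo fun y hy =>
        mul_nonneg (Qker_neg_nonneg ha.1 hy.1.le) (ih y hy).1)
    · calc _ ≤ startFactor α a x *
            ((∫ y in Ioo a 1, Qker (α / 2) a x (-y)) * escapeBound α a ^ n) :=
          mul_le_mul_of_nonneg_left (integral_Qker_neg_mul_le hβ ha.1 (Ioo_subset_Ico_self hx)
            (measurable_fseq α a n) (fun y hy => (ih y hy).1) (fun y hy => (ih y hy).2)) hw.le
        _ ≤ _ := by
          rw [← mul_assoc, pow_succ']
          exact mul_le_mul_of_nonneg_right (startFactor_mul_integral_le hα ha hx)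
            (pow_nonneg (escapeBound_pos ha.1).le n)

lemma abs_fseq_le_one {α a : ℝ} (hα : α ∈ Ioo (0:ℝ) 2) (ha : a ∈ Ioo (0:ℝ) 1) (n : ℕ) :
    ∀ x ∈ Ioo a 1, |fseq α a n x| ≤ 1 := fun x hx => by
  obtain ⟨h0, h1⟩ := fseq_mem_Icc hα ha n x hx
  rw [abs_of_nonneg h0]
  exact h1.trans (pow_le_one₀ (escapeBound_pos ha.1).le (escapeBound_lt_one ha.1).le)

lemma summable_fseq {α a x : ℝ} (hα : α ∈ Ioo (0:ℝ) 2) (ha : a ∈ Ioo (0:ℝ) 1)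
    (hx : x ∈ Ioo a 1) : Summable fun n => fseq α a n x :=
  Summable.of_nonneg_of_le (fun n => (fseq_mem_Icc hα ha n x hx).1)
    (fun n => (fseq_mem_Icc hα ha n x hx).2)
    (summable_geometric_of_lt_one (escapeBound_pos ha.1).le (escapeBound_lt_one ha.1))

lemma measurable_ff (α a : ℝ) : Measurable (ff α a) :=
  Measurable.tsum fun n => measurable_fseq α a n

lemma sum_fseq_le_one {α a : ℝ} (hα : α ∈ Ioo (0:ℝ) 2) (ha : a ∈ Ioo (0:ℝ) 1) (N : ℕ) :
    ∀ x ∈ Ioo a 1, ∑ n ∈ Finset.range N, fseq α a n x ≤ 1 := by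
  have hβ := half_mem_Ioo hα
  induction N with
  | zero => simp
  | succ N ih =>
    intro x hx
    have hx' := Ioo_subset_Ico_self hx
    have hw := startFactor_pos hα hx
    rw [Finset.sum_range_succ', fseq_zero_eq hα ha hx]
    simp only [fseq_succ_eq ha hx]
    rw [← Finset.mul_sum, ← integral_finsetSum _ fun n _ =>
      integrableOn_Qker_neg_mul hβ ha.1 hx' (measurable_fseq α a n) (abs_fseq_le_one hα ha n)]
    simp only [← Finset.mul_sum]
    have h1 := integral_Qker_neg_mul_le hβ ha.1 hx'
      (g := fun y => ∑ n ∈ Finset.range N, fseq α a n y)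
      (Finset.measurable_fun_sum _ fun n _ => measurable_fseq α a n)
      (fun y hy => Finset.sum_nonneg fun n _ => (fseq_mem_Icc hα ha n y hy).1) ih
    have h2 := integral_Ioo_Qker_neg_le hβ ha.1 hx'
    have h3 : 0 ≤ ∫ y in Ioi 1, Qker (α / 2) a x y :=
      setIntegral_nonneg measurableSet_Ioi fun y hy => Qker_nonneg_of_one_lt ha.2.le hy
    have h4 : 0 ≤ startFactor α a x *
        ((∫ y in Ioi 1, Qker (α / 2) a x y) + (∫ y in Ioi a, Qker (α / 2) a x (-y)) -
          ∫ y in Ioo a 1, Qker (α / 2) a x (-y) * ∑ n ∈ Finset.range N, fseq α a n y) :=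
      mul_nonneg hw.le (by linarith)
    linarith

lemma ff_mem_Icc {α a x : ℝ} (hα : α ∈ Ioo (0:ℝ) 2) (ha : a ∈ Ioo (0:ℝ) 1)
    (hx : x ∈ Ioo a 1) : ff α a x ∈ Icc 0 1 :=
  ⟨tsum_nonneg fun n => (fseq_mem_Icc hα ha n x hx).1,
    Real.tsum_le_of_sum_range_le (fun n => (fseq_mem_Icc hα ha n x hx).1)
      fun N => sum_fseq_le_one hα ha N x hx⟩

lemma ff_eq {α a x : ℝ} (hα : α ∈ Ioo (0:ℝ) 2) (ha : a ∈ Ioo (0:ℝ) 1) (hx : x ∈ Ioo a 1) :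
    ff α a x = fseq α a 0 x +
      startFactor α a x * ∫ y in Ioo a 1, Qker (α / 2) a x (-y) * ff α a y := by
  have hβ := half_mem_Ioo hα
  have hx' := Ioo_subset_Ico_self hx
  have hw := startFactor_pos hα hx
  have hs := summable_fseq hα ha hx
  rw [ff, hs.tsum_eq_zero_add]
  congr 1
  have h := integral_tsum_of_summable_integral_norm (μ := volume.restrict (Ioo a 1))
    (F := fun n y => Qker (α / 2) a x (-y) * fseq α a n y)
    (fun n => integrableOn_Qker_neg_mul hβ ha.1 hx' (measurable_fseq α a n)
      (abs_fseq_le_one hα ha n)) ?_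
  · simp only [fseq_succ_eq ha hx, tsum_mul_left, h, ff]
  · have h2 : ∀ n, ∫ y in Ioo a 1, ‖Qker (α / 2) a x (-y) * fseq α a n y‖ =
        (startFactor α a x)⁻¹ * fseq α a (n + 1) x := fun n => by
      rw [fseq_succ_eq ha hx, inv_mul_cancel_left₀ hw.ne']
      refine setIntegral_congr_fun measurableSet_Ioo fun y hy => norm_of_nonneg ?_
      exact mul_nonneg (Qker_neg_nonneg ha.1 hy.1.le) (fseq_mem_Icc hα ha n y hy).1
    simp only [h2]
    exact ((summable_nat_add_iff 1).2 hs).mul_left _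

/-- The bracket in the formula for `Ψ`, with the pole `a` of `Φ` moved to `x`. -/
noncomputable def escapeIntegral (α a x : ℝ) : ℝ :=
  (∫ y in Ioi 1, Qker (α / 2) a x y) + (∫ y in Ioi a, Qker (α / 2) a x (-y)) -
    ∫ y in Ioo a 1, Qker (α / 2) a x (-y) * ff α a y

lemma one_sub_ff {α a x : ℝ} (hα : α ∈ Ioo (0:ℝ) 2) (ha : a ∈ Ioo (0:ℝ) 1) (hx : x ∈ Ioo a 1) :
    1 - ff α a x = startFactor α a x * escapeIntegral α a x := by
  rw [ff_eq hα ha hx, fseq_zero_eq hα ha hx, escapeIntegral]; ring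

lemma Phi_eq_Qker (α a y : ℝ) : Phi α a y = Qker (α / 2) a a y := by
  rw [Phi, Qker, abs_sub_comm]

lemma Psi_eq {α a : ℝ} (ha : a ∈ Ioo (0:ℝ) 1) :
    Psi α a = Cc α * (1 - a) ^ (α / 2) * escapeIntegral α a a := by
  rw [Psi, escapeIntegral, intervalIntegral.integral_of_le ha.2.le, integral_Ioc_eq_integral_Ioo]
  simp only [Phi_eq_Qker]

lemma Psi_pos {α a : ℝ} (hα : α ∈ Ioo (0:ℝ) 2) (ha : a ∈ Ioo (0:ℝ) 1) : 0 < Psi α a := by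
  have hβ := half_mem_Ioo hα
  have hx' : a ∈ Ico a 1 := ⟨le_rfl, ha.2⟩
  rw [Psi_eq ha]
  refine mul_pos (mul_pos (Cc_pos hα) (rpow_pos_of_pos (by linarith [ha.2]) _)) ?_
  have h1 := integral_Qker_neg_mul_le hβ ha.1 hx' (measurable_ff α a)
    (fun y hy => (ff_mem_Icc hα ha hy).1) (fun y hy => (ff_mem_Icc hα ha hy).2)
  have h2 := integral_Ioo_Qker_neg_le hβ ha.1 hx'
  have h3 := le_integral_Qker_Ioi hβ ha.1 hx'
  have h4 : (0:ℝ) < 2 ^ (-(α / 2 + 1)) := by positivity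
  rw [escapeIntegral]
  linarith

/-- Pairs `(a, x)` with `x` in `[a, 1)`: the left endpoint is allowed as a starting point. -/
def startDomain : Set (ℝ × ℝ) := {p | 0 < p.1 ∧ p.1 ≤ p.2 ∧ p.2 < 1}

lemma continuousAt_Qker {β : ℝ} {y : ℝ × ℝ → ℝ} {p : ℝ × ℝ} (hy : ContinuousAt y p)
    (h1 : (y p - p.1) * (y p - 1) ≠ 0) (h2 : p.2 ≠ y p) :
    ContinuousAt (fun p => Qker β p.1 p.2 (y p)) p := by
  unfold Qker
  refine ContinuousAt.mul (ContinuousAt.rpow_const (by fun_prop) (Or.inl h1)) ?_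
  exact ContinuousAt.inv₀ (by fun_prop) (abs_ne_zero.2 (sub_ne_zero.2 h2))

lemma continuousOn_integral_Qker_Ioi {β : ℝ} (hβ : β ∈ Ioo (0:ℝ) 1) :
    ContinuousOn (fun p : ℝ × ℝ => ∫ y in Ioi 1, Qker β p.1 p.2 y) startDomain := by
  rintro ⟨a, x⟩ ⟨ha, hax, hx⟩
  simp only at ha hax hx
  obtain ⟨d, hd⟩ : ∃ d, d = (1 + x) / 2 := ⟨_, rfl⟩
  obtain ⟨c, hc⟩ : ∃ c, c = (x + d) / 2 := ⟨_, rfl⟩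
  refine continuousWithinAt_of_dominated (bound := Qker β c d)
    (Eventually.of_forall fun p => (measurable_Qker _ _ _).aestronglyMeasurable) ?_
    (integrableOn_Qker_Ioi hβ ⟨by linarith, by linarith⟩) ?_
  · have e1 : ∀ᶠ p : ℝ × ℝ in nhds (a, x), p.1 < c :=
      continuousAt_fst.eventually_lt_const (show a < c by linarith)
    have e2 : ∀ᶠ p : ℝ × ℝ in nhds (a, x), p.2 < d :=
      continuousAt_snd.eventually_lt_const (show x < d by linarith)
    filter_upwards [nhdsWithin_le_nhds e1, nhdsWithin_le_nhds e2] with p h1 h2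
    filter_upwards [ae_restrict_mem measurableSet_Ioi] with y hy
    rw [norm_of_nonneg (Qker_nonneg_of_one_lt (by linarith) hy)]
    exact Qker_le_Qker_of_one_lt hβ.1.le h1.le (by linarith) h2.le (by linarith) hy
  · filter_upwards [ae_restrict_mem measurableSet_Ioi] with y hy
    have hy : 1 < y := hy
    refine (continuousAt_Qker continuousAt_const ?_ ?_).continuousWithinAt
    · exact mul_ne_zero (by simp only; linarith) (by linarith)
    · simp only; linarith

lemma continuousOn_integral_Qker_neg {β : ℝ} (hβ : β ∈ Ioo (0:ℝ) 1) :
    ContinuousOn (fun p : ℝ × ℝ => ∫ y in Ioi p.1, Qker β p.1 p.2 (-y)) startDomain := by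
  simp only [fun p : ℝ × ℝ => integral_Ioi_comp_neg (Qker β p.1 p.2) p.1]
  rintro ⟨a, x⟩ ⟨ha, hax, hx⟩
  simp only at ha hax hx
  refine continuousWithinAt_of_dominated
    (bound := fun s => Qker β (a / 4) (3 * a / 4) (-(a / 4) - s))
    (Eventually.of_forall fun p =>
      ((measurable_Qker _ _ _).comp (measurable_id.const_sub _)).aestronglyMeasurable) ?_
    (integrableOn_Qker_neg_sub hβ (by linarith) ⟨by linarith, by linarith⟩) ?_
  · have e1 : ∀ᶠ p : ℝ × ℝ in nhds (a, x), a / 2 < p.1 :=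
      continuousAt_fst.eventually_const_lt (show a / 2 < a by linarith)
    filter_upwards [nhdsWithin_le_nhds e1, self_mem_nhdsWithin] with p h1 h2
    obtain ⟨h3, h4, h5⟩ := h2
    filter_upwards [ae_restrict_mem measurableSet_Ioi] with s hs
    have hs : 0 < s := hs
    rw [norm_of_nonneg (Qker_nonneg (by nlinarith))]
    exact Qker_le_Qker_neg hβ.1.le (by linarith) (by linarith) (by linarith) (by linarith) hs.le
  · filter_upwards [ae_restrict_mem measurableSet_Ioi] with s hs
    have hs : 0 < s := hs
    refine (continuousAt_Qker (by fun_prop) ?_ ?_).continuousWithinAt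
    · exact mul_ne_zero (by simp only; linarith) (by simp only; linarith)
    · simp only; linarith

lemma integral_Ioo_eq_integral_unit {a : ℝ} (ha : a < 1) (f : ℝ → ℝ) :
    ∫ y in Ioo a 1, f y = (1 - a) * ∫ s in Ioo (0:ℝ) 1, f (a + (1 - a) * s) := by
  have h := intervalIntegral.smul_integral_comp_add_mul (a := 0) (b := 1) f (1 - a) a
  rw [intervalIntegral.integral_of_le zero_le_one, integral_Ioc_eq_integral_Ioo, mul_zero,
    add_zero, mul_one, add_sub_cancel, intervalIntegral.integral_of_le ha.le,
    integral_Ioc_eq_integral_Ioo] at h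
  exact h.symm

lemma add_mul_mem_Ioo {a s : ℝ} (ha : a < 1) (hs : s ∈ Ioo (0:ℝ) 1) :
    a + (1 - a) * s ∈ Ioo a 1 :=
  ⟨by nlinarith [hs.1], by nlinarith [hs.2]⟩

lemma continuousOn_integral_Qker_neg_mul {β : ℝ} (hβ : β ∈ Ioo (0:ℝ) 1) {F : ℝ → ℝ → ℝ}
    (hm : ∀ a, Measurable (F a)) (hb : ∀ a ∈ Ioo (0:ℝ) 1, ∀ y ∈ Ioo a 1, |F a y| ≤ 1)
    (hF : ∀ s ∈ Ioo (0:ℝ) 1, ContinuousOn (fun a => F a (a + (1 - a) * s)) (Ioo 0 1)) :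
    ContinuousOn (fun p : ℝ × ℝ => ∫ y in Ioo p.1 1, Qker β p.1 p.2 (-y) * F p.1 y)
      startDomain := by
  have hlt : ∀ p ∈ startDomain, p.1 < 1 := fun p hp => hp.2.1.trans_lt hp.2.2
  refine ContinuousOn.congr (f := fun p : ℝ × ℝ => (1 - p.1) * ∫ s in Ioo (0:ℝ) 1,
    Qker β p.1 p.2 (-(p.1 + (1 - p.1) * s)) * F p.1 (p.1 + (1 - p.1) * s))
    (ContinuousOn.mul (by fun_prop) ?_) fun p hp => integral_Ioo_eq_integral_unit (hlt p hp) _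
  rintro ⟨a, x⟩ ⟨ha, hax, hx⟩
  simp only at ha hax hx
  refine continuousWithinAt_of_dominated (bound := fun _ => a ^ (-(β + 1)))
    (Eventually.of_forall fun p => Measurable.aestronglyMeasurable
      (((measurable_Qker _ _ _).comp (by fun_prop)).mul ((hm _).comp (by fun_prop)))) ?_
    (integrable_const _) ?_
  · have e1 : ∀ᶠ p : ℝ × ℝ in nhds (a, x), a / 2 < p.1 :=
      continuousAt_fst.eventually_const_lt (show a / 2 < a by linarith)
    filter_upwards [nhdsWithin_le_nhds e1, self_mem_nhdsWithin] with p h1 h2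
    obtain ⟨h3, h4, h5⟩ := h2
    filter_upwards [ae_restrict_mem measurableSet_Ioo] with s hs
    have hy := add_mul_mem_Ioo (h4.trans_lt h5) hs
    rw [norm_mul, norm_of_nonneg (Qker_neg_nonneg h3 hy.1.le), ← mul_one (a ^ (-(β + 1)))]
    refine mul_le_mul ((Qker_neg_le_const hβ.1 h3 h4 hy.1.le).trans ?_)
      (hb _ ⟨h3, h4.trans_lt h5⟩ _ hy) (norm_nonneg _) (by positivity)
    exact rpow_le_rpow_of_nonpos ha (by linarith) (by linarith [hβ.1])
  · filter_upwards [ae_restrict_mem measurableSet_Ioo] with s hs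
    have hy := add_mul_mem_Ioo (hax.trans_lt hx) hs
    refine ContinuousWithinAt.mul (continuousAt_Qker (by fun_prop) ?_ ?_).continuousWithinAt ?_
    · exact mul_ne_zero (by simp only; linarith [hy.1]) (by simp only; linarith [hy.1])
    · simp only; linarith [hy.1]
    · exact ContinuousWithinAt.comp (x := (a, x)) (f := Prod.fst) (t := Ioo 0 1)
        (hF s hs a ⟨ha, hax.trans_lt hx⟩) continuous_fst.continuousWithinAt
        fun p hp => ⟨hp.1, hlt p hp⟩

lemma continuousOn_startFactor {α s : ℝ} (hα : α ∈ Ioo (0:ℝ) 2) :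
    ContinuousOn (fun a => startFactor α a (a + (1 - a) * s)) (Ioo 0 1) := by
  unfold startFactor
  exact continuousOn_const.mul
    (ContinuousOn.rpow_const (by fun_prop) fun _ _ => Or.inr (half_mem_Ioo hα).1.le)

lemma mapsTo_startDomain {s : ℝ} (hs : s ∈ Ico (0:ℝ) 1) :
    MapsTo (fun a => (a, a + (1 - a) * s)) (Ioo 0 1) startDomain := fun a ha =>
  ⟨ha.1, by nlinarith [ha.2, hs.1], by nlinarith [ha.2, hs.2]⟩

lemma continuousOn_fseq {α : ℝ} (hα : α ∈ Ioo (0:ℝ) 2) (n : ℕ) :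
    ∀ s ∈ Ioo (0:ℝ) 1, ContinuousOn (fun a => fseq α a n (a + (1 - a) * s)) (Ioo 0 1) := by
  have hβ := half_mem_Ioo hα
  have hc (s : ℝ) : ContinuousOn (fun a : ℝ => (a, a + (1 - a) * s)) (Ioo 0 1) := by fun_prop
  induction n with
  | zero =>
    intro s hs
    have hs' := mapsTo_startDomain (Ioo_subset_Ico_self hs)
    refine ContinuousOn.congr ?_ fun a ha => fseq_zero_eq hα ha (add_mul_mem_Ioo ha.2 hs)
    exact continuousOn_const.sub ((continuousOn_startFactor hα).mul
      (((continuousOn_integral_Qker_Ioi hβ).comp (hc s) hs').add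
        ((continuousOn_integral_Qker_neg hβ).comp (hc s) hs')))
  | succ n ih =>
    intro s hs
    have hs' := mapsTo_startDomain (Ioo_subset_Ico_self hs)
    refine ContinuousOn.congr ?_ fun a ha => fseq_succ_eq ha (add_mul_mem_Ioo ha.2 hs) n
    exact (continuousOn_startFactor hα).mul ((continuousOn_integral_Qker_neg_mul hβ
      (fun a => measurable_fseq α a n) (fun a ha => abs_fseq_le_one hα ha n) ih).comp (hc s) hs')

lemma continuousOn_ff {α s : ℝ} (hα : α ∈ Ioo (0:ℝ) 2) (hs : s ∈ Ioo (0:ℝ) 1) :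
    ContinuousOn (fun a => ff α a (a + (1 - a) * s)) (Ioo 0 1) := by
  intro a ha
  have hc : 0 < a / 2 := by linarith [ha.1]
  have hsub : Ioo (a / 2) 1 ⊆ Ioo (0:ℝ) 1 := Ioo_subset_Ioo_left hc.le
  have h : ContinuousOn (fun a => ff α a (a + (1 - a) * s)) (Ioo (a / 2) 1) := by
    refine continuousOn_tsum (u := fun n => escapeBound α (a / 2) ^ n)
      (fun n => (continuousOn_fseq hα n s hs).mono hsub)
      (summable_geometric_of_lt_one (escapeBound_pos hc).le (escapeBound_lt_one hc))
      fun n b hb => ?_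
    obtain ⟨h0, h1⟩ := fseq_mem_Icc hα (hsub hb) n _ (add_mul_mem_Ioo hb.2 hs)
    rw [norm_of_nonneg h0]
    exact h1.trans (pow_le_pow_left₀ (escapeBound_pos (hsub hb).1).le
      (escapeBound_anti hα.1 hc hb.1.le) n)
  exact (h.continuousAt (Ioo_mem_nhds (by linarith) ha.2)).continuousWithinAt

lemma continuousOn_escapeIntegral {α : ℝ} (hα : α ∈ Ioo (0:ℝ) 2) :
    ContinuousOn (fun p : ℝ × ℝ => escapeIntegral α p.1 p.2) startDomain := by
  have hβ := half_mem_Ioo hα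
  refine ((continuousOn_integral_Qker_Ioi hβ).add (continuousOn_integral_Qker_neg hβ)).sub
    (continuousOn_integral_Qker_neg_mul hβ (measurable_ff α) (fun a ha y hy => ?_)
      fun s hs => continuousOn_ff hα hs)
  obtain ⟨h0, h1⟩ := ff_mem_Icc hα ha hy
  rwa [abs_of_nonneg h0]

lemma continuousOn_Psi {α : ℝ} (hα : α ∈ Ioo (0:ℝ) 2) : ContinuousOn (Psi α) (Ioo 0 1) := by
  refine ContinuousOn.congr (ContinuousOn.mul (continuousOn_const.mul
    (ContinuousOn.rpow_const (by fun_prop) fun _ _ => Or.inr (half_mem_Ioo hα).1.le)) ?_)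
    fun a ha => Psi_eq ha
  exact (continuousOn_escapeIntegral hα).comp (f := fun a : ℝ => (a, a)) (by fun_prop)
    fun a ha => ⟨ha.1, le_rfl, ha.2⟩

lemma tendsto_one_sub_ff {α a : ℝ} (hα : α ∈ Ioo (0:ℝ) 2) (ha : a ∈ Ioo (0:ℝ) 1) :
    Tendsto (fun h : ℝ => h ^ (-(α / 2)) * (1 - ff α a (a + h)))
      (nhdsWithin 0 (Ioi 0)) (nhds (Psi α a)) := by
  have ha1 : 0 < 1 - a := by linarith [ha.2]
  have hc : ContinuousOn (fun h : ℝ => Cc α * (1 - a - h) ^ (α / 2) * escapeIntegral α a (a + h))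
      (Ico 0 (1 - a)) := by
    refine (continuousOn_const.mul (ContinuousOn.rpow_const (by fun_prop) fun _ _ =>
      Or.inr (half_mem_Ioo hα).1.le)).mul ?_
    exact (continuousOn_escapeIntegral hα).comp (f := fun h : ℝ => (a, a + h)) (by fun_prop)
      fun h hh => ⟨ha.1, by simpa using hh.1, by simp only; linarith [hh.2]⟩
  have ht := (hc 0 ⟨le_rfl, ha1⟩).mono Ioo_subset_Ico_self
  rw [ContinuousWithinAt, nhdsWithin_Ioo_eq_nhdsGT ha1, sub_zero, add_zero, ← Psi_eq ha] at ht
  refine ht.congr' ?_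
  filter_upwards [Ioo_mem_nhdsGT ha1] with h hh
  have hr := (rpow_pos_of_pos hh.1 (α / 2)).ne'
  rw [one_sub_ff hα ha ⟨by linarith [hh.1], by linarith [hh.2]⟩, startFactor, add_sub_cancel_left,
    ← sub_sub, mul_rpow hh.1.le (by linarith [hh.2]), rpow_neg hh.1.le]
  field_simp

/-- For `α ∈ (0,2)` and `a ∈ (0,1)`, `lim_{h→0⁺} h^(-α/2) (1 - f_a(a+h))` exists and equals
`Ψ(a)`; moreover `Ψ(a) ∈ (0,∞)` for every `a ∈ (0,1)` and `Ψ` is continuous on `(0,1)`. -/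
theorem Psi_props (α : ℝ) (hα : α ∈ Set.Ioo (0:ℝ) 2) :
    (∀ a ∈ Set.Ioo (0:ℝ) 1,
      Tendsto (fun h : ℝ => h ^ (-(α / 2)) * (1 - ff α a (a + h)))
        (nhdsWithin 0 (Set.Ioi 0)) (nhds (Psi α a)) ∧
      0 < Psi α a) ∧
    ContinuousOn (Psi α) (Set.Ioo (0:ℝ) 1) := by
  exact ⟨fun a ha => ⟨tendsto_one_sub_ff hα ha, Psi_pos hα ha⟩, continuousOn_Psi hα⟩
end
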